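/- For any probability distributions P and Q on the same finite index set (nonnegative real entries summing to 1), DL(P, Q) ≥ 0. -/

import Mathlib

open Real Finset

/-- lit(p,q) = |p(1 - log p) - q(1 - log q)|, natural log, with 0*log 0 = 0
(automatic since Real.log 0 = 0). -/
noncomputable def lit (p q : ℝ) : ℝ :=
  |p * (1 - Real.log p) - q * (1 - Real.log q)|

/-- δh(p,q) = |p²(1 - 2 log p) - q²(1 - 2 log q)| / (2(p+q)), with δh(0,0) = 0
(automatic since division by zero is 0 in Lean). -/
noncomputable def deltaH (p q : ℝ) : ℝ :=
  |p ^ 2 * (1 - 2 * Real.log p) - q ^ 2 * (1 - 2 * Real.log q)| / (2 * (p + q))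

/-- dl(p,q) = lit(p,q) - δh(p,q). -/
noncomputable def dl (p q : ℝ) : ℝ := lit p q - deltaH p q

/-- DLITE of two distributions on a finite index set: DL(P,Q) = ∑ i, dl(P i, Q i). -/
noncomputable def DL {ι : Type*} [Fintype ι] (P Q : ι → ℝ) : ℝ :=
  ∑ i, dl (P i) (Q i)

/-- `IsProbDist P` : nonnegative real entries summing to 1. -/
def IsProbDist {ι : Type*} [Fintype ι] (P : ι → ℝ) : Prop :=
  (∀ i, 0 ≤ P i) ∧ ∑ i, P i = 1

theorem mul_one_sub_log_le {p q : ℝ} (hq : 0 ≤ q) (hqp : q ≤ p) (hp : p ≤ 1) :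
    q * (1 - Real.log q) ≤ p * (1 - Real.log p) := by
  have hlp : Real.log p ≤ 0 := Real.log_nonpos (hq.trans hqp) hp
  rcases hq.eq_or_lt with rfl | hq
  · rw [zero_mul]
    exact mul_nonneg hqp (by linarith)
  have hp0 : 0 < p := hq.trans_le hqp
  have h := Real.log_le_sub_one_of_pos (div_pos hp0 hq)
  rw [Real.log_div hp0.ne' hq.ne'] at h
  have h1 : q * (Real.log p - Real.log q) ≤ p - q := by
    calc q * (Real.log p - Real.log q) ≤ q * (p / q - 1) := by gcongr
      _ = p - q := by field_simp
  nlinarith [mul_nonneg (sub_nonneg.2 hqp) (neg_nonneg.2 hlp)]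

theorem two_mul_mul_log_sub_log_le {p q : ℝ} (hq : 0 ≤ q) (hqp : q ≤ p) :
    2 * (p * q) * (Real.log p - Real.log q) ≤ p ^ 2 - q ^ 2 := by
  rcases hq.eq_or_lt with rfl | hq
  · simpa using sq_nonneg p
  have hp0 : 0 < p := hq.trans_le hqp
  have h := Real.self_le_sinh_iff.2 (Real.log_nonneg ((one_le_div hq).2 hqp))
  rw [Real.sinh_log (div_pos hp0 hq), Real.log_div hp0.ne' hq.ne'] at h
  calc 2 * (p * q) * (Real.log p - Real.log q)
      ≤ 2 * (p * q) * ((p / q - (p / q)⁻¹) / 2) := by gcongr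
    _ = p ^ 2 - q ^ 2 := by field_simp

theorem dl_comm (p q : ℝ) : dl p q = dl q p := by
  simp only [dl, lit, deltaH]
  rw [abs_sub_comm, abs_sub_comm (p ^ 2 * _), add_comm p q]

theorem dl_nonneg {p q : ℝ} (hp : 0 ≤ p) (hp1 : p ≤ 1) (hq : 0 ≤ q) (hq1 : q ≤ 1) :
    0 ≤ dl p q := by
  wlog hqp : q ≤ p generalizing p q
  · rw [dl_comm]
    exact this hq hq1 hp hp1 (le_of_not_ge hqp)
  have hf := mul_one_sub_log_le hq hqp hp1
  have hg := mul_one_sub_log_le (sq_nonneg q) (pow_le_pow_left₀ hq hqp 2) (pow_le_one₀ hp hp1)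
  simp only [Real.log_pow, Nat.cast_ofNat] at hg
  rw [dl, lit, deltaH, abs_of_nonneg (sub_nonneg.2 hf), abs_of_nonneg (sub_nonneg.2 hg),
    sub_nonneg]
  refine div_le_of_le_mul₀ (by positivity) (sub_nonneg.2 hf) ?_
  linarith [two_mul_mul_log_sub_log_le hq hqp]

theorem IsProbDist.le_one {ι : Type*} [Fintype ι] {P : ι → ℝ} (hP : IsProbDist P) (i : ι) :
    P i ≤ 1 :=
  hP.2 ▸ Finset.single_le_sum (fun j _ => hP.1 j) (Finset.mem_univ i)

theorem DL_nonneg {ι : Type*} [Fintype ι] (P Q : ι → ℝ)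
    (hP : IsProbDist P) (hQ : IsProbDist Q) :
    0 ≤ DL P Q :=
  Finset.sum_nonneg fun i _ => dl_nonneg (hP.1 i) (hP.le_one i) (hQ.1 i) (hQ.le_one i)
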